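/- arXiv:2309.08202 — 4 statements merged into one kernel-verified Lean document; each statement's English description precedes it below -/
import Mathlib

section
/- Let G be a finitely generated abelian group and ω ∈ G, and let Ḡ = G/⟨ω⟩ denote the quotient of G by the cyclic subgroup generated by ω. Then ω = 0 if and only if both of the following hold: (i) the torsion-free rank of G equals the torsion-free rank of Ḡ, and (ii) the torsion subgroup of G and the torsion subgroup of Ḡ have the same (finite) cardinality. -/
open TensorProduct

namespace AddCommGroup

variable {G : Type*} [AddCommGroup G]

theorem finite_torsion_of_fg [AddGroup.FG G] : Finite (torsion G) := by
  have : Module.Finite ℤ G := Module.Finite.iff_addGroup_fg.mpr inferInstance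
  have : Module.Finite ℤ (torsion G) :=
    inferInstanceAs (Module.Finite ℤ (AddSubgroup.toIntSubmodule (torsion G)))
  have : AddGroup.FG (torsion G) := Module.Finite.iff_addGroup_fg.mp this
  exact finite_of_fg_isAddTorsion _ AddCommMonoid.addTorsion.isAddTorsion

theorem isOfFinAddOrder_of_one_tmul_eq_zero {ω : G} (h : (1 : ℚ) ⊗ₜ[ℤ] ω = 0) :
    IsOfFinAddOrder ω := by
  obtain ⟨c, hc⟩ := (IsLocalizedModule.eq_zero_iff (nonZeroDivisors ℤ)
    (TensorProduct.mk ℤ ℚ G 1)).mp h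
  exact isOfFinAddOrder_iff_zsmul_eq_zero.mpr ⟨c, nonZeroDivisors.coe_ne_zero c, hc⟩

/-- An element whose quotient does not lower the rank is torsion. -/
theorem isOfFinAddOrder_of_finrank_eq [AddGroup.FG G] {ω : G}
    (h : Module.finrank ℚ (ℚ ⊗[ℤ] G) =
      Module.finrank ℚ (ℚ ⊗[ℤ] (G ⧸ AddSubgroup.zmultiples ω))) :
    IsOfFinAddOrder ω := by
  have : Module.Finite ℤ G := Module.Finite.iff_addGroup_fg.mpr inferInstance
  have : Module.Finite ℤ (G ⧸ AddSubgroup.zmultiples ω) :=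
    Module.Finite.iff_addGroup_fg.mpr inferInstance
  let π := (QuotientAddGroup.mk' (AddSubgroup.zmultiples ω)).toIntLinearMap
  have hπ : Function.Surjective (π.baseChange ℚ) :=
    LinearMap.lTensor_surjective ℚ (QuotientAddGroup.mk'_surjective _)
  have hinj := (LinearMap.injective_iff_surjective_of_finrank_eq_finrank h).mpr hπ
  refine isOfFinAddOrder_of_one_tmul_eq_zero (hinj ?_)
  have hω : π ω = 0 :=
    (QuotientAddGroup.eq_zero_iff ω).mpr (AddSubgroup.mem_zmultiples ω)
  rw [LinearMap.baseChange_tmul, hω, tmul_zero, map_zero]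

theorem isOfFinAddOrder_of_mk_zmultiples {ω g : G} (hω : IsOfFinAddOrder ω)
    (hg : IsOfFinAddOrder (g : G ⧸ AddSubgroup.zmultiples ω)) : IsOfFinAddOrder g := by
  obtain ⟨n, hn, hng⟩ := isOfFinAddOrder_iff_nsmul_eq_zero.mp hg
  obtain ⟨k, hk⟩ := AddSubgroup.mem_zmultiples_iff.mp
    ((QuotientAddGroup.eq_zero_iff (n • g)).mp hng)
  exact (hk ▸ hω.zsmul : IsOfFinAddOrder (n • g)).of_nsmul (Nat.ne_of_gt hn)

/-- A torsion element whose quotient has as many torsion elements is zero. -/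
theorem eq_zero_of_card_torsion_eq [Finite (torsion G)] {ω : G} (hω : IsOfFinAddOrder ω)
    (h : Nat.card (torsion G) = Nat.card (torsion (G ⧸ AddSubgroup.zmultiples ω))) :
    ω = 0 := by
  let f : torsion G → torsion (G ⧸ AddSubgroup.zmultiples ω) := fun g =>
    ⟨(g : G), (QuotientAddGroup.mk' (AddSubgroup.zmultiples ω)).isOfFinAddOrder g.2⟩
  have hf : Function.Surjective f := by
    rintro ⟨x, hx⟩
    obtain ⟨g, rfl⟩ := QuotientAddGroup.mk_surjective x
    exact ⟨⟨g, isOfFinAddOrder_of_mk_zmultiples hω hx⟩, rfl⟩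
  have hinj : Function.Injective f := (hf.bijective_of_nat_card_le h.le).1
  have hωf : f ⟨ω, hω⟩ = f 0 := Subtype.ext
    ((QuotientAddGroup.eq_zero_iff ω).mpr (AddSubgroup.mem_zmultiples ω))
  exact congrArg Subtype.val (hinj hωf)

theorem card_torsion_congr {H : Type*} [AddCommGroup H] (e : G ≃+ H) :
    Nat.card (torsion G) = Nat.card (torsion H) :=
  Nat.card_congr <| e.toEquiv.subtypeEquiv fun _ =>
    (SetLike.ext_iff.mp e.comap_torsion _).symm

end AddCommGroup

/-- Let `G` be a finitely generated abelian group, `ω ∈ G`, and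
`Ḡ = G/⟨ω⟩`. Then `ω = 0` if and only if (i) the torsion-free rank of `G` (the dimension
of `ℚ ⊗_ℤ G`) equals that of `Ḡ`, and (ii) the torsion subgroups of `G` and `Ḡ` have the
same cardinality. -/
theorem eq_zero_iff_rank_and_torsion_card_eq (G : Type) [AddCommGroup G] [AddGroup.FG G]
    (ω : G) :
    ω = 0 ↔
      (Module.finrank ℚ (ℚ ⊗[ℤ] G) =
          Module.finrank ℚ (ℚ ⊗[ℤ] (G ⧸ AddSubgroup.zmultiples ω)) ∧
        Nat.card (AddCommGroup.torsion G) =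
          Nat.card (AddCommGroup.torsion (G ⧸ AddSubgroup.zmultiples ω))) := by
  constructor
  · rintro rfl
    let e : G ⧸ AddSubgroup.zmultiples (0 : G) ≃+ G :=
      (QuotientAddGroup.quotientAddEquivOfEq AddSubgroup.zmultiples_zero_eq_bot).trans
        QuotientAddGroup.quotientBot
    exact ⟨(e.symm.toIntLinearEquiv.baseChange ℤ ℚ _ _).finrank_eq,
      AddCommGroup.card_torsion_congr e.symm⟩
  · rintro ⟨hrank, hcard⟩
    have : Finite (AddCommGroup.torsion G) := AddCommGroup.finite_torsion_of_fg
    exact AddCommGroup.eq_zero_of_card_torsion_eq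
      (AddCommGroup.isOfFinAddOrder_of_finrank_eq hrank) hcard
end

section
/- The all-ones vector 𝟙 ∈ ℤ^{E(P̂)} belongs to the subgroup L generated by {v_z : z ∈ P̂ \ {1̂}} if and only if P is pure. Equivalently, the class [𝟙] is zero in G = ℤ^{E(P̂)} / L if and only if every maximal chain of P has the same cardinality. -/
noncomputable section
attribute [local instance] Classical.propDecidable

variable (P : Type) [PartialOrder P] [Fintype P]

/-- `P̂ = P ∪ {0̂, 1̂}`, obtained from `P` by adjoining a bottom element `0̂ = ⊥` and a
top element `1̂ = ⊤`. -/
abbrev Phat := WithBot (WithTop P)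

/-- The set of edges of the Hasse diagram of `P̂`: pairs `(x, y)` with `y` covering `x`. -/
def Edge := {e : Phat P × Phat P // e.1 ⋖ e.2}

instance : Fintype (Phat P) := inferInstanceAs (Fintype (Option (Option P)))

instance : Fintype (Edge P) := by unfold Edge; infer_instance

/-- The support-form vector `v_z ∈ ℤ^{E(P̂)}` of `z ∈ P̂`: its coordinate at an edge `e`
is `1` if `z` is the lower endpoint of `e`, `-1` if `z` is the upper endpoint of `e`,
and `0` otherwise. -/
def vz (z : Phat P) : Edge P → ℤ :=
  fun e => if e.1.1 = z then 1 else if e.1.2 = z then -1 else 0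

/-- The subgroup `L ⊆ ℤ^{E(P̂)}` generated by the vectors `v_z`, `z ∈ P̂ \ {1̂}`. -/
def L : Submodule ℤ (Edge P → ℤ) :=
  Submodule.span ℤ {v | ∃ z : Phat P, z ≠ ⊤ ∧ v = vz P z}

/-- `G = ℤ^{E(P̂)} / L`, which is Chouinard's presentation of the divisor class group
of the join-meet (Hibi) ring of `P`. -/
abbrev ClGroup := (Edge P → ℤ) ⧸ L P

/-- The all-ones vector `𝟙 ∈ ℤ^{E(P̂)}`, representing the canonical class. -/
def allOnes : Edge P → ℤ := fun _ => 1

/-- `P` is pure: every maximal chain of `P` has the same cardinality. -/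
def IsPure : Prop :=
  ∀ c₁ c₂ : Set P, IsMaxChain (· ≤ ·) c₁ → IsMaxChain (· ≤ ·) c₂ → c₁.ncard = c₂.ncard


section MaxChain

variable {α : Type*} [PartialOrder α]

/-- A maximal chain contains every element comparable to all of its members. -/
lemma IsMaxChain.mem_of_forall_le_or_ge {C : Set α} (hC : IsMaxChain (· ≤ ·) C) {x : α}
    (h : ∀ y ∈ C, x ≤ y ∨ y ≤ x) : x ∈ C := by
  have hins : IsChain (· ≤ ·) (insert x C) := hC.1.insert fun y hy _ => h y hy
  rw [hC.2 hins (Set.subset_insert x C)]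
  exact Set.mem_insert x C

/-- Gluing the lower part of a maximal chain to the upper part of another one, at a common
element, gives a maximal chain. -/
lemma IsMaxChain.inter_Iic_union_inter_Ici {C D : Set α} (hC : IsMaxChain (· ≤ ·) C)
    (hD : IsMaxChain (· ≤ ·) D) {x : α} (hxC : x ∈ C) (hxD : x ∈ D) :
    IsMaxChain (· ≤ ·) (C ∩ Set.Iic x ∪ D ∩ Set.Ici x) := by
  refine ⟨?_, fun t ht hsub => subset_antisymm hsub fun y hy => ?_⟩
  · rintro a (⟨ha, hax⟩ | ⟨ha, hax⟩) b (⟨hb, hbx⟩ | ⟨hb, hbx⟩) -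
    · exact hC.1.total ha hb
    · exact Or.inl (le_trans hax hbx)
    · exact Or.inr (le_trans hbx hax)
    · exact hD.1.total ha hb
  · have hxt : x ∈ t := hsub (Or.inl ⟨hxC, le_rfl⟩)
    rcases ht.total hy hxt with hyx | hxy
    · refine Or.inl ⟨hC.mem_of_forall_le_or_ge fun z hz => ?_, hyx⟩
      rcases hC.1.total hz hxC with hzx | hxz
      · exact ht.total hy (hsub (Or.inl ⟨hz, hzx⟩))
      · exact Or.inl (hyx.trans hxz)
    · refine Or.inr ⟨hD.mem_of_forall_le_or_ge fun z hz => ?_, hxy⟩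
      rcases hD.1.total hz hxD with hzx | hxz
      · exact Or.inr (hzx.trans hxy)
      · exact ht.total hy (hsub (Or.inr ⟨hz, hxz⟩))

lemma IsChain.inter_Iic_eq_insert {C : Set α} (hC : IsChain (· ≤ ·) C) {x y : α}
    (hx : x ∈ C) (hy : y ∈ C) (hxy : x ⋖ y) :
    C ∩ Set.Iic y = insert y (C ∩ Set.Iic x) := by
  ext z
  simp only [Set.mem_inter_iff, Set.mem_Iic, Set.mem_insert_iff]
  constructor
  · rintro ⟨hz, hzy⟩
    rcases hC.total hz hx with hzx | hxz
    · exact Or.inr ⟨hz, hzx⟩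
    · rcases hxy.eq_or_eq hxz hzy with rfl | rfl
      · exact Or.inr ⟨hz, le_rfl⟩
      · exact Or.inl rfl
  · rintro (rfl | ⟨hz, hzx⟩)
    · exact ⟨hy, le_rfl⟩
    · exact ⟨hz, hzx.trans hxy.le⟩

variable [Finite α]

lemma IsChain.ncard_inter_Iic_of_covBy {C : Set α} (hC : IsChain (· ≤ ·) C) {x y : α}
    (hx : x ∈ C) (hy : y ∈ C) (hxy : x ⋖ y) :
    (C ∩ Set.Iic y).ncard = (C ∩ Set.Iic x).ncard + 1 := by
  rw [hC.inter_Iic_eq_insert hx hy hxy,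
    Set.ncard_insert_of_notMem fun h => hxy.lt.not_ge h.2]

lemma IsMaxChain.exists_covBy [OrderBot α] {C : Set α} (hC : IsMaxChain (· ≤ ·) C) {y : α}
    (hy : y ∈ C) (hbot : y ≠ ⊥) : ∃ x ∈ C, x ⋖ y := by
  obtain ⟨x, hx⟩ := (Set.toFinite (C ∩ Set.Iio y)).exists_maximal
    ⟨⊥, hC.bot_mem, bot_lt_iff_ne_bot.2 hbot⟩
  refine ⟨x, hx.prop.1, hx.prop.2, fun z hxz hzy => ?_⟩
  have hz : z ∈ C := hC.mem_of_forall_le_or_ge fun w hw => by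
    rcases hC.1.total hw hy with hwy | hyw
    · rcases hC.1.total hw hx.prop.1 with hwx | hxw
      · exact Or.inr (hwx.trans hxz.le)
      · rcases hwy.eq_or_lt with rfl | hlt
        · exact Or.inl hzy.le
        · exact Or.inr ((hx.le_of_ge ⟨hw, hlt⟩ hxw).trans hxz.le)
    · exact Or.inl (hzy.le.trans hyw)
  exact hxz.not_ge (hx.le_of_ge ⟨hz, hzy⟩ hxz.le)

/-- A function increasing by one along covering relations counts the elements of maximal chains. -/
lemma IsMaxChain.ncard_inter_Iic_eq [OrderBot α] {g : α → ℤ}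
    (hg : ∀ x y, x ⋖ y → g y = g x + 1) {C : Set α} (hC : IsMaxChain (· ≤ ·) C) (x : α) :
    x ∈ C → ((C ∩ Set.Iic x).ncard : ℤ) = g x - g ⊥ + 1 := by
  induction x using WellFoundedLT.induction with
  | ind x ih =>
    intro hx
    by_cases hbot : x = ⊥
    · subst hbot
      have : C ∩ Set.Iic ⊥ = {⊥} := by simpa using hx
      rw [this, Set.ncard_singleton]
      simp
    · obtain ⟨y, hy, hyx⟩ := hC.exists_covBy hx hbot
      rw [hC.1.ncard_inter_Iic_of_covBy hy hx hyx, hg y x hyx]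
      push_cast
      rw [ih y hyx.lt hy]
      ring

lemma IsMaxChain.ncard_inter_Iic_congr
    (h : ∀ C D : Set α, IsMaxChain (· ≤ ·) C → IsMaxChain (· ≤ ·) D → C.ncard = D.ncard)
    {C D : Set α} (hC : IsMaxChain (· ≤ ·) C) (hD : IsMaxChain (· ≤ ·) D) {x : α}
    (hxC : x ∈ C) (hxD : x ∈ D) : (C ∩ Set.Iic x).ncard = (D ∩ Set.Iic x).ncard := by
  have key : ∀ A : Set α, x ∈ A →
      (A ∩ Set.Iic x ∪ D ∩ Set.Ici x).ncard + 1 =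
        (A ∩ Set.Iic x).ncard + (D ∩ Set.Ici x).ncard := by
    intro A hxA
    rw [← Set.ncard_union_add_ncard_inter (A ∩ Set.Iic x) (D ∩ Set.Ici x)]
    have : (A ∩ Set.Iic x) ∩ (D ∩ Set.Ici x) = {x} := by
      ext z
      simp only [Set.mem_inter_iff, Set.mem_Iic, Set.mem_Ici, Set.mem_singleton_iff]
      constructor
      · rintro ⟨⟨-, hzx⟩, -, hxz⟩
        exact le_antisymm hzx hxz
      · rintro rfl
        exact ⟨⟨hxA, le_rfl⟩, hxD, le_rfl⟩
    rw [this, Set.ncard_singleton]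
  have hcard := h _ _ (hC.inter_Iic_union_inter_Ici hD hxC hxD)
    (hD.inter_Iic_union_inter_Ici hD hxD hxD)
  have h₁ := key C hxC
  have h₂ := key D hxD
  omega

/-- A finite bounded poset admits an integer-valued function increasing by one along covering
relations if and only if all its maximal chains have the same cardinality. -/
theorem exists_covBy_add_one_iff [BoundedOrder α] :
    (∃ g : α → ℤ, ∀ x y, x ⋖ y → g y = g x + 1) ↔
      ∀ C D : Set α, IsMaxChain (· ≤ ·) C → IsMaxChain (· ≤ ·) D → C.ncard = D.ncard := by
  constructor
  · rintro ⟨g, hg⟩ C D hC hD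
    have h₁ := hC.ncard_inter_Iic_eq hg ⊤ hC.top_mem
    have h₂ := hD.ncard_inter_Iic_eq hg ⊤ hD.top_mem
    rw [Set.Iic_top, Set.inter_univ] at h₁ h₂
    omega
  · intro h
    have hex : ∀ x : α, ∃ C : Set α, IsMaxChain (· ≤ ·) C ∧ x ∈ C := fun x => by
      obtain ⟨C, hC, hsub⟩ := (IsChain.singleton (r := (· ≤ ·)) (a := x)).exists_maxChain
      exact ⟨C, hC, hsub rfl⟩
    choose M hM hxM using hex
    refine ⟨fun x => (M x ∩ Set.Iic x).ncard, fun x y hxy => ?_⟩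
    obtain ⟨C, hC, hsub⟩ := (IsChain.pair (r := (· ≤ ·)) hxy.le).exists_maxChain
    have hx : x ∈ C := hsub (by simp)
    have hy : y ∈ C := hsub (by simp)
    simp only
    rw [(hM y).ncard_inter_Iic_congr h hC (hxM y) hy,
      (hM x).ncard_inter_Iic_congr h hC (hxM x) hx, hC.1.ncard_inter_Iic_of_covBy hx hy hxy]
    push_cast
    rfl

end MaxChain

section Phat

variable {Q : Type} [PartialOrder Q]

/-- The inclusion of a poset into its extension by `0̂` and `1̂`. -/
def toPhat (x : Q) : Phat Q := ((x : WithTop Q) : WithBot (WithTop Q))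

lemma toPhat_le_toPhat {x y : Q} : toPhat x ≤ toPhat y ↔ x ≤ y := by
  simp [toPhat]

lemma toPhat_injective : Function.Injective (toPhat : Q → Phat Q) := fun _ _ h =>
  le_antisymm (toPhat_le_toPhat.1 h.le) (toPhat_le_toPhat.1 h.ge)

lemma insert_bot_insert_top_image_preimage {C : Set (Phat Q)} (hbot : ⊥ ∈ C) (htop : ⊤ ∈ C) :
    insert ⊥ (insert ⊤ (toPhat '' (toPhat ⁻¹' C))) = C := by
  ext z
  induction z using WithBot.recBotCoe with
  | bot => simpa using hbot
  | coe z =>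
    induction z using WithTop.recTopCoe with
    | top => exact ⟨fun _ => htop, fun _ => Or.inr (Or.inl rfl)⟩
    | coe z =>
      constructor
      · rintro (h | h | ⟨w, hw, h⟩)
        · cases h
        · cases h
        · exact h ▸ hw
      · exact fun h => Or.inr (Or.inr ⟨z, h, rfl⟩)

lemma IsChain.image_toPhat {c : Set Q} (hc : IsChain (· ≤ ·) c) :
    IsChain (· ≤ ·) (toPhat '' c) := by
  rintro _ ⟨x, hx, rfl⟩ _ ⟨y, hy, rfl⟩ -
  simpa only [toPhat_le_toPhat] using hc.total hx hy

lemma IsChain.preimage_toPhat {C : Set (Phat Q)} (hC : IsChain (· ≤ ·) C) :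
    IsChain (· ≤ ·) (toPhat ⁻¹' C) := fun x hx y hy _ => by
  simpa only [toPhat_le_toPhat] using hC.total hx hy

lemma IsMaxChain.preimage_toPhat {C : Set (Phat Q)} (hC : IsMaxChain (· ≤ ·) C) :
    IsMaxChain (· ≤ ·) (toPhat ⁻¹' C) := by
  refine ⟨hC.1.preimage_toPhat, fun t ht hsub => subset_antisymm hsub fun x hx => ?_⟩
  have hchain : IsChain (· ≤ ·) (insert ⊥ (insert ⊤ (toPhat '' t))) :=
    (ht.image_toPhat.insert fun _ _ _ => Or.inr le_top).insert fun _ _ _ => Or.inl bot_le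
  have hle : C ⊆ insert ⊥ (insert ⊤ (toPhat '' t)) := by
    rw [← insert_bot_insert_top_image_preimage hC.bot_mem hC.top_mem]
    gcongr
  rw [Set.mem_preimage, hC.2 hchain hle]
  exact Or.inr (Or.inr ⟨x, hx, rfl⟩)

lemma IsMaxChain.exists_preimage_toPhat_eq {c : Set Q} (hc : IsMaxChain (· ≤ ·) c) :
    ∃ C : Set (Phat Q), IsMaxChain (· ≤ ·) C ∧ toPhat ⁻¹' C = c := by
  obtain ⟨C, hC, hsub⟩ := hc.1.image_toPhat.exists_maxChain
  exact ⟨C, hC, (hc.2 hC.1.preimage_toPhat (Set.image_subset_iff.1 hsub)).symm⟩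

lemma IsMaxChain.ncard_eq_ncard_preimage_toPhat_add_two [Finite Q] {C : Set (Phat Q)}
    (hC : IsMaxChain (· ≤ ·) C) : C.ncard = (toPhat ⁻¹' C).ncard + 2 := by
  have htop : (⊤ : Phat Q) ∉ toPhat '' (toPhat ⁻¹' C) := by
    rintro ⟨x, -, h⟩
    cases h
  have hbot : (⊥ : Phat Q) ∉ insert ⊤ (toPhat '' (toPhat ⁻¹' C)) := by
    rintro (h | ⟨x, -, h⟩) <;> cases h
  have hfin : (toPhat '' (toPhat ⁻¹' C)).Finite := (Set.toFinite _).image _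
  conv_lhs => rw [← insert_bot_insert_top_image_preimage hC.bot_mem hC.top_mem]
  rw [Set.ncard_insert_of_notMem hbot (hfin.insert _), Set.ncard_insert_of_notMem htop hfin,
    Set.ncard_image_of_injective _ toPhat_injective]

end Phat

lemma isPure_iff_phat : IsPure P ↔ ∀ C D : Set (Phat P),
    IsMaxChain (· ≤ ·) C → IsMaxChain (· ≤ ·) D → C.ncard = D.ncard := by
  constructor
  · intro h C D hC hD
    rw [hC.ncard_eq_ncard_preimage_toPhat_add_two, hD.ncard_eq_ncard_preimage_toPhat_add_two,
      h _ _ hC.preimage_toPhat hD.preimage_toPhat]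
  · intro h c d hc hd
    obtain ⟨C, hC, rfl⟩ := hc.exists_preimage_toPhat_eq
    obtain ⟨D, hD, rfl⟩ := hd.exists_preimage_toPhat_eq
    have hcard := h C D hC hD
    rw [hC.ncard_eq_ncard_preimage_toPhat_add_two,
      hD.ncard_eq_ncard_preimage_toPhat_add_two] at hcard
    omega

/-- `L` consists of the differences, along edges, of functions on `P̂` vanishing at `1̂`. -/
lemma mem_L_iff (v : Edge P → ℤ) :
    v ∈ L P ↔ ∃ f : Phat P → ℤ, f ⊤ = 0 ∧ ∀ e : Edge P, v e = f e.1.1 - f e.1.2 := by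
  constructor
  · intro hv
    induction hv using Submodule.span_induction with
    | mem v hv =>
      obtain ⟨z, hz, rfl⟩ := hv
      refine ⟨fun w => if w = z then 1 else 0, if_neg hz.symm, fun e => ?_⟩
      have hne : e.1.1 ≠ e.1.2 := e.2.ne
      simp only [vz]
      split_ifs with h₁ h₂ <;> simp_all
    | zero => exact ⟨0, rfl, fun e => by simp⟩
    | add v w _ _ hv hw =>
      obtain ⟨f, hf, hvf⟩ := hv
      obtain ⟨g, hg, hwg⟩ := hw
      refine ⟨f + g, by simp [hf, hg], fun e => ?_⟩
      simp only [Pi.add_apply, hvf, hwg]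
      ring
    | smul a v _ hv =>
      obtain ⟨f, hf, hvf⟩ := hv
      refine ⟨a • f, by simp [hf], fun e => ?_⟩
      simp only [Pi.smul_apply, hvf, smul_sub]
  · rintro ⟨f, hf, hvf⟩
    have hsum : v = ∑ z : Phat P, f z • vz P z := by
      ext e
      have hne : e.1.1 ≠ e.1.2 := e.2.ne
      have hterm : ∀ z, f z * vz P z e =
          (if e.1.1 = z then f z else 0) - (if e.1.2 = z then f z else 0) := fun z => by
        simp only [vz]
        split_ifs with h₁ h₂ <;> simp_all
      simp [hvf, Finset.sum_apply, hterm]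
    rw [hsum]
    refine Submodule.sum_mem _ fun z _ => ?_
    by_cases hz : z = ⊤
    · simp [hz, hf]
    · exact Submodule.smul_mem _ _ (Submodule.subset_span ⟨z, hz, rfl⟩)

lemma allOnes_mem_L_iff :
    allOnes P ∈ L P ↔ ∃ g : Phat P → ℤ, ∀ x y, x ⋖ y → g y = g x + 1 := by
  rw [mem_L_iff]
  constructor
  · rintro ⟨f, -, h⟩
    refine ⟨-f, fun x y hxy => ?_⟩
    have hedge : (1 : ℤ) = f x - f y := h ⟨(x, y), hxy⟩
    simp only [Pi.neg_apply]
    omega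
  · rintro ⟨g, hg⟩
    refine ⟨fun x => g ⊤ - g x, sub_self _, fun e => ?_⟩
    have hedge := hg _ _ e.2
    simp only [allOnes]
    omega

/-- **Theorem 2.1.** The all-ones vector `𝟙 ∈ ℤ^{E(P̂)}` belongs to the
subgroup `L` generated by `{v_z : z ∈ P̂ \ {1̂}}` if and only if `P` is pure, i.e.,
every maximal chain of `P` has the same cardinality. Equivalently, the canonical class
`[𝟙]` is zero in `G = ℤ^{E(P̂)} / L` iff `P` is pure. -/
theorem allOnes_mem_iff_pure : allOnes P ∈ L P ↔ IsPure P := by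
  rw [allOnes_mem_L_iff, isPure_iff_phat, exists_covBy_add_one_iff]

end
end

section
/- Suppose L_1 : x_0 < x_1 < ⋯ < x_a and L_2 : y_0 < y_1 < ⋯ < y_b are maximal chains of P with x_i ≠ y_j for all i and j. Then there exists a group homomorphism φ : ℤ^{E(P̂)} → ℤ such that φ(v_z) = 0 for every z ∈ P̂ \ {1̂} and φ(𝟙) = a − b, where 𝟙 ∈ ℤ^{E(P̂)} is the all-ones vector. -/
noncomputable section
attribute [local instance] Classical.propDecidable

variable (P : Type) [PartialOrder P] [Fintype P]

/-- The chain `x₀ < ⋯ < x_a` of `P` extended to `P̂` by `0̂` below and by `1̂` above. -/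
def extendChain {a : ℕ} (x : Fin (a + 1) → P) : ℕ → Phat P
  | 0 => ⊥
  | k + 1 => if h : k < a + 1 then ((x ⟨k, h⟩ : WithTop P) : Phat P) else ⊤

set_option linter.unusedSectionVars false

variable {P}

theorem extendChain_lt_succ {a : ℕ} {x : Fin (a + 1) → P} (hx : StrictMono x) {i : ℕ}
    (hi : i < a + 2) : extendChain P x i < extendChain P x (i + 1) := by
  rcases i with _ | k
  · simp [extendChain]
  · have hk : k < a + 1 := by omega
    by_cases hk' : k + 1 < a + 1
    · simpa [extendChain, hk, hk'] using hx (show (⟨k, hk⟩ : Fin (a + 1)) < ⟨k + 1, hk'⟩ by simp)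
    · simp only [extendChain, hk, hk', dite_true, dite_false]
      exact WithBot.coe_lt_coe.2 (WithTop.coe_lt_top _)

theorem extendChain_monotone {a : ℕ} {x : Fin (a + 1) → P} (hx : StrictMono x) :
    Monotone (extendChain P x) := by
  refine monotone_nat_of_le_succ fun i => ?_
  by_cases hi : i < a + 2
  · exact (extendChain_lt_succ hx hi).le
  · have : extendChain P x (i + 1) = ⊤ := by
      simp [extendChain, show ¬ i < a + 1 by omega]
    exact this ▸ le_top

theorem extendChain_covBy_succ {a : ℕ} {x : Fin (a + 1) → P} (hx : StrictMono x)
    (hmx : IsMaxChain (· ≤ ·) (Set.range x)) {i : ℕ} (hi : i < a + 2) :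
    extendChain P x i ⋖ extendChain P x (i + 1) := by
  refine ⟨extendChain_lt_succ hx hi, fun c hc hc' => ?_⟩
  have hmono := extendChain_monotone hx
  have hval (j : Fin (a + 1)) : extendChain P x (j + 1) = ((x j : WithTop P) : Phat P) := by
    simp [extendChain, Nat.lt_succ_iff.1 j.2]
  have hside (j : Fin (a + 1)) : extendChain P x (j + 1) < c ∨ c < extendChain P x (j + 1) := by
    rcases Nat.lt_or_ge i (j + 1) with h | h
    · exact .inr (hc'.trans_le (hmono h))
    · exact .inl ((hmono h).trans_lt hc)
  induction c using WithBot.recBotCoe with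
  | bot => exact not_lt_bot hc
  | coe c =>
    induction c using WithTop.recTopCoe with
    | top => exact not_top_lt hc'
    | coe p =>
      have hchain : IsChain (· ≤ ·) (insert p (Set.range x)) := by
        refine hmx.1.insert ?_
        rintro _ ⟨j, rfl⟩ -
        rcases hside j with h | h <;> rw [hval] at h
        · exact .inr (by simpa using h.le)
        · exact .inl (by simpa using h.le)
      obtain ⟨j, rfl⟩ : p ∈ Set.range x :=
        hmx.2 hchain (Set.subset_insert _ _) ▸ Set.mem_insert _ _
      rcases hside j with h | h
      · exact h.ne (hval j)
      · exact h.ne' (hval j)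

theorem vz_apply_eq_sub (z : Phat P) (e : Edge P) :
    vz P z e = (if e.1.1 = z then 1 else 0) - (if e.1.2 = z then 1 else 0) := by
  have := e.2.ne
  unfold vz
  split_ifs <;> simp_all

/-- Summation along the edges of a maximal chain, as a functional on `ℤ^{E(P̂)}`. -/
theorem exists_hom_sum_along_chain {a : ℕ} {x : Fin (a + 1) → P} (hx : StrictMono x)
    (hmx : IsMaxChain (· ≤ ·) (Set.range x)) :
    ∃ φ : (Edge P → ℤ) →+ ℤ,
      (∀ z : Phat P, z ≠ ⊤ → φ (vz P z) = if ⊥ = z then 1 else 0) ∧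
        φ (allOnes P) = (a : ℤ) + 2 := by
  let edge (i : Fin (a + 2)) : Edge P :=
    ⟨(extendChain P x i, extendChain P x (i + 1)), extendChain_covBy_succ hx hmx i.2⟩
  refine ⟨∑ i, Pi.evalAddMonoidHom (fun _ => ℤ) (edge i), fun z hz => ?_, ?_⟩
  · have htop : extendChain P x (a + 2) = ⊤ := by simp [extendChain]
    have htel := Finset.sum_range_sub' (fun i => if extendChain P x i = z then (1 : ℤ) else 0)
      (a + 2)
    rw [← Fin.sum_univ_eq_sum_range (fun i => (if extendChain P x i = z then (1 : ℤ) else 0) -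
      if extendChain P x (i + 1) = z then 1 else 0), htop, if_neg hz.symm, sub_zero] at htel
    simp only [AddMonoidHom.finsetSum_apply, Pi.evalAddMonoidHom_apply, vz_apply_eq_sub]
    exact htel
  · simp [AddMonoidHom.finsetSum_apply, allOnes]

variable (P)

/-- **Proposition 3.2.** Suppose `L₁ : x₀ < x₁ < ⋯ < x_a` and
`L₂ : y₀ < y₁ < ⋯ < y_b` are maximal chains of `P` with `xᵢ ≠ yⱼ` for all `i, j`.
Then there is a group homomorphism `φ : ℤ^{E(P̂)} → ℤ` with `φ(v_z) = 0` for every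
`z ∈ P̂ \ {1̂}` and `φ(𝟙) = a − b`. -/
theorem exists_hom_killing_relations (a b : ℕ) (x : Fin (a + 1) → P) (y : Fin (b + 1) → P)
    (hx : StrictMono x) (hy : StrictMono y)
    (hmx : IsMaxChain (· ≤ ·) (Set.range x)) (hmy : IsMaxChain (· ≤ ·) (Set.range y))
    (hxy : ∀ i j, x i ≠ y j) :
    ∃ φ : (Edge P → ℤ) →+ ℤ,
      (∀ z : Phat P, z ≠ ⊤ → φ (vz P z) = 0) ∧ φ (allOnes P) = (a : ℤ) - (b : ℤ) := by
  obtain ⟨φ, hφ, hφ'⟩ := exists_hom_sum_along_chain hx hmx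
  obtain ⟨ψ, hψ, hψ'⟩ := exists_hom_sum_along_chain hy hmy
  refine ⟨φ - ψ, fun z hz => ?_, ?_⟩
  · rw [AddMonoidHom.sub_apply, hφ z hz, hψ z hz, sub_self]
  · rw [AddMonoidHom.sub_apply, hφ', hψ']
    ring

end
end

section
/- Let a, b ≥ 0 and let P be the disjoint union of two chains P_1 : x_0 < x_1 < ⋯ < x_a and P_2 : y_0 < y_1 < ⋯ < y_b (no element of P_1 is comparable to any element of P_2). Then G = ℤ^{E(P̂)} / L is an infinite cyclic group, and there is a generator g of G such that the class of the all-ones vector satisfies [𝟙] = (a − b) · g. -/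
noncomputable section
attribute [local instance] Classical.propDecidable

variable (P : Type) [PartialOrder P] [Fintype P]

section HasseGraph

variable {Q : Type}

/-- The sequence `0̂, p 0, …, p n, 1̂, 1̂, …` in `P̂`. -/
def hatSeq {n : ℕ} (p : Fin (n + 1) → Q) : ℕ → Phat Q
  | 0 => ⊥
  | i + 1 => if h : i < n + 1 then ((p ⟨i, h⟩ : WithTop Q) : Phat Q) else ⊤

@[simp]
lemma hatSeq_zero {n : ℕ} (p : Fin (n + 1) → Q) : hatSeq p 0 = ⊥ := rfl

lemma hatSeq_val_add_one {n : ℕ} (p : Fin (n + 1) → Q) (i : Fin (n + 1)) :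
    hatSeq p (i + 1) = ((p i : WithTop Q) : Phat Q) :=
  dif_pos i.2

@[simp]
lemma hatSeq_add_two {n : ℕ} (p : Fin (n + 1) → Q) : hatSeq p (n + 2) = ⊤ := by
  simp [hatSeq]

variable [PartialOrder Q]

lemma hatSeq_covBy {n : ℕ} {p : Fin (n + 1) → Q} (hmin : IsMin (p 0))
    (hmax : IsMax (p (Fin.last n))) (hcov : ∀ i : Fin n, p i.castSucc ⋖ p i.succ) :
    ∀ i < n + 2, hatSeq p i ⋖ hatSeq p (i + 1) := by
  rintro (_ | i) hi
  · have : hatSeq p (0 + 1) = _ := hatSeq_val_add_one p 0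
    rw [hatSeq_zero, this, WithBot.bot_covBy_coe]
    intro x hx
    induction x with
    | top => exact le_top
    | coe x => exact WithTop.coe_le_coe.2 (hmin (WithTop.coe_le_coe.1 hx))
  · obtain hi | rfl : i < n ∨ i = n := by omega
    · have h₁ := hatSeq_val_add_one p (Fin.castSucc ⟨i, hi⟩)
      have h₂ := hatSeq_val_add_one p (Fin.succ ⟨i, hi⟩)
      simp only [Fin.val_castSucc, Fin.val_succ] at h₁ h₂
      rw [h₁, h₂, WithBot.coe_covBy_coe, WithTop.coe_covBy_coe]
      exact hcov _
    · have h := hatSeq_val_add_one p (Fin.last i)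
      rw [Fin.val_last] at h
      rw [h, hatSeq_add_two, ← WithBot.coe_top, WithBot.coe_covBy_coe, WithTop.coe_covBy_top]
      exact hmax

/-- The coordinate of a vector of `ℤ^{E(P̂)}` at the edge `(x, y)`, and `0` if `y` does not
cover `x`. -/
def edgeCoord (x y : Phat Q) : (Edge Q → ℤ) →ₗ[ℤ] ℤ :=
  if h : x ⋖ y then LinearMap.proj (R := ℤ) (φ := fun _ : Edge Q => ℤ) ⟨(x, y), h⟩ else 0

lemma edgeCoord_eq (e : Edge Q) (f : Edge Q → ℤ) : edgeCoord e.1.1 e.1.2 f = f e := by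
  rw [edgeCoord, dif_pos e.2]
  rfl

lemma vz_apply (z : Phat Q) (e : Edge Q) :
    vz Q z e = (if e.1.1 = z then 1 else 0) - (if e.1.2 = z then 1 else 0) := by
  have hne := e.2.ne
  unfold vz
  grind

/-- The sum of the coordinates along the first `n` steps of the sequence `c`. -/
def pathSum (c : ℕ → Phat Q) (n : ℕ) : (Edge Q → ℤ) →ₗ[ℤ] ℤ :=
  ∑ i ∈ Finset.range n, edgeCoord (c i) (c (i + 1))

lemma pathSum_apply (c : ℕ → Phat Q) (n : ℕ) (f : Edge Q → ℤ) :
    pathSum c n f = ∑ i ∈ Finset.range n, edgeCoord (c i) (c (i + 1)) f := by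
  simp [pathSum]

/-- On a vector given by a function of the endpoints of an edge, `pathSum` is the sum of the
values of that function. -/
lemma pathSum_of_endpoints {c : ℕ → Phat Q} {n : ℕ} (hc : ∀ i < n, c i ⋖ c (i + 1))
    (F : Phat Q → Phat Q → ℤ) :
    pathSum c n (fun e => F e.1.1 e.1.2) = ∑ i ∈ Finset.range n, F (c i) (c (i + 1)) := by
  rw [pathSum_apply]
  exact Finset.sum_congr rfl fun i hi => edgeCoord_eq ⟨(_, _), hc i (Finset.mem_range.1 hi)⟩ _

lemma pathSum_vz {c : ℕ → Phat Q} {n : ℕ} (hc : ∀ i < n, c i ⋖ c (i + 1)) (z : Phat Q) :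
    pathSum c n (vz Q z) = (if c 0 = z then 1 else 0) - (if c n = z then 1 else 0) := by
  rw [← Finset.sum_range_sub' (fun i => if c i = z then (1 : ℤ) else 0), funext (vz_apply z)]
  exact pathSum_of_endpoints hc fun x y => (if x = z then 1 else 0) - (if y = z then 1 else 0)

lemma pathSum_allOnes {c : ℕ → Phat Q} {n : ℕ} (hc : ∀ i < n, c i ⋖ c (i + 1)) :
    pathSum c n (allOnes Q) = n :=
  (pathSum_of_endpoints hc fun _ _ => 1).trans (by simp)

/-- A vector that is the coboundary of a potential vanishing at `1̂` lies in `L`. -/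
lemma mem_L_of_potential [Fintype Q] (f : Edge Q → ℤ) (u : Phat Q → ℤ) (htop : u ⊤ = 0)
    (hf : ∀ e : Edge Q, f e = u e.1.1 - u e.1.2) : f ∈ L Q := by
  have key : f = ∑ z : Phat Q, u z • vz Q z := by
    funext e
    simp [hf e, vz_apply, mul_sub, Finset.sum_sub_distrib]
  rw [key]
  refine Submodule.sum_mem _ fun z _ => ?_
  by_cases hz : z = ⊤
  · simp [hz, htop]
  · exact Submodule.smul_mem _ _ (Submodule.subset_span ⟨z, hz, rfl⟩)

end HasseGraph

section TwoChains

open Sum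

variable {a b : ℕ}

lemma inl_covBy_inl {α β : Type*} [Preorder α] [Preorder β] {x y : α} :
    (inl x : α ⊕ β) ⋖ inl y ↔ x ⋖ y := by
  simp [CovBy]

lemma inr_covBy_inr {α β : Type*} [Preorder α] [Preorder β] {x y : β} :
    (inr x : α ⊕ β) ⋖ inr y ↔ x ⋖ y := by
  simp [CovBy]

lemma fin_covBy_iff {n : ℕ} {i j : Fin n} : i ⋖ j ↔ (j : ℕ) = i + 1 := by
  refine ⟨fun h => ?_, fun h => ⟨Fin.lt_def.2 (by omega), fun k h₁ h₂ => ?_⟩⟩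
  · have hlt := Fin.lt_def.1 h.lt
    by_contra hne
    exact h.2 (c := ⟨i + 1, by omega⟩) (Fin.lt_def.2 (by simp))
      (Fin.lt_def.2 (by simp only; omega))
  · rw [Fin.lt_def] at h₁ h₂
    omega

lemma hatSeq_inl_covBy :
    ∀ i < a + 2, hatSeq (inl : _ → Fin (a + 1) ⊕ Fin (b + 1)) i ⋖ hatSeq inl (i + 1) :=
  hatSeq_covBy (by rintro (x | x) h <;> simp_all) (by rintro (x | x) h <;> simp_all)
    fun i => inl_covBy_inl.2 (fin_covBy_iff.2 (by simp))

lemma hatSeq_inr_covBy :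
    ∀ i < b + 2, hatSeq (inr : _ → Fin (a + 1) ⊕ Fin (b + 1)) i ⋖ hatSeq inr (i + 1) :=
  hatSeq_covBy (by rintro (x | x) h <;> simp_all) (by rintro (x | x) h <;> simp_all)
    fun i => inr_covBy_inr.2 (fin_covBy_iff.2 (by simp))

/-- Every edge of the Hasse diagram lies on one of the two maximal chains. -/
lemma exists_hatSeq_of_covBy {x y : Phat (Fin (a + 1) ⊕ Fin (b + 1))} (h : x ⋖ y) :
    (∃ i < a + 2, x = hatSeq inl i ∧ y = hatSeq inl (i + 1)) ∨
      ∃ i < b + 2, x = hatSeq inr i ∧ y = hatSeq inr (i + 1) := by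
  have hbot (p : Fin (a + 1) ⊕ Fin (b + 1)) (hx : x = ⊥)
      (hp : ((p : WithTop (Fin (a + 1) ⊕ Fin (b + 1))) : WithBot _) ≤ y) :
      y = ((p : WithTop (Fin (a + 1) ⊕ Fin (b + 1))) : WithBot _) := by
    subst hx
    exact ((h.eq_or_eq bot_le hp).resolve_left WithBot.coe_ne_bot).symm
  cases x using WithBot.recBotCoe with
  | bot =>
    cases y using WithBot.recBotCoe with
    | bot => exact absurd rfl h.ne
    | coe y =>
      cases y using WithTop.recTopCoe with
      | top =>
        exact absurd (WithBot.coe_injective (hbot (inl 0) rfl le_top)) WithTop.top_ne_coe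
      | coe y =>
        rcases y with j | j
        · left
          have := hbot (inl 0) rfl (by simp)
          exact ⟨0, by omega, rfl, this.trans (hatSeq_val_add_one inl 0).symm⟩
        · right
          have := hbot (inr 0) rfl (by simp)
          exact ⟨0, by omega, rfl, this.trans (hatSeq_val_add_one inr 0).symm⟩
  | coe x =>
    cases y using WithBot.recBotCoe with
    | bot => exact absurd h.lt not_lt_bot
    | coe y =>
      rw [WithBot.coe_covBy_coe] at h
      cases x using WithTop.recTopCoe with
      | top => exact absurd h.lt not_top_lt
      | coe x =>
        cases y using WithTop.recTopCoe with
        | top =>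
          rw [WithTop.coe_covBy_top] at h
          rcases x with i | i
          · have hi : i = Fin.last a :=
              Fin.last_le_iff.1 (inl_le_inl_iff.1 (h (inl_le_inl_iff.2 (Fin.le_last i))))
            subst hi
            exact .inl ⟨a + 1, by omega, (hatSeq_val_add_one inl (Fin.last a)).symm,
              (hatSeq_add_two inl).symm⟩
          · have hi : i = Fin.last b :=
              Fin.last_le_iff.1 (inr_le_inr_iff.1 (h (inr_le_inr_iff.2 (Fin.le_last i))))
            subst hi
            exact .inr ⟨b + 1, by omega, (hatSeq_val_add_one inr (Fin.last b)).symm,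
              (hatSeq_add_two inr).symm⟩
        | coe y =>
          rw [WithTop.coe_covBy_coe] at h
          rcases x with i | i <;> rcases y with j | j
          · have hij := fin_covBy_iff.1 (inl_covBy_inl.1 h)
            exact .inl ⟨i + 1, by omega, (hatSeq_val_add_one inl i).symm,
              by rw [← hij]; exact (hatSeq_val_add_one inl j).symm⟩
          · exact absurd h.lt not_inl_lt_inr
          · exact absurd h.lt not_inr_lt_inl
          · have hij := fin_covBy_iff.1 (inr_covBy_inr.1 h)
            exact .inr ⟨i + 1, by omega, (hatSeq_val_add_one inr i).symm,
              by rw [← hij]; exact (hatSeq_val_add_one inr j).symm⟩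

/-- Prescribed increments along the two maximal chains come from a potential as soon as their
total sums agree. -/
lemma exists_potential (F G : ℕ → ℤ)
    (hFG : ∑ i ∈ Finset.range (a + 2), F i = ∑ i ∈ Finset.range (b + 2), G i) :
    ∃ u : Phat (Fin (a + 1) ⊕ Fin (b + 1)) → ℤ, u ⊤ = 0 ∧
      (∀ i < a + 2, F i = u (hatSeq inl i) - u (hatSeq inl (i + 1))) ∧
      ∀ i < b + 2, G i = u (hatSeq inr i) - u (hatSeq inr (i + 1)) := by
  let u : Phat (Fin (a + 1) ⊕ Fin (b + 1)) → ℤ :=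
    WithBot.recBotCoe (∑ k ∈ Finset.Ico 0 (a + 2), F k)
      (WithTop.recTopCoe 0 (Sum.elim (fun i => ∑ k ∈ Finset.Ico (i + 1 : ℕ) (a + 2), F k)
        fun i => ∑ k ∈ Finset.Ico (i + 1 : ℕ) (b + 2), G k))
  have hl : ∀ i ≤ a + 2, u (hatSeq inl i) = ∑ k ∈ Finset.Ico i (a + 2), F k := by
    rintro (_ | i) hi
    · rfl
    · obtain hi | rfl : i < a + 1 ∨ i = a + 1 := by omega
      · exact congrArg u (hatSeq_val_add_one inl ⟨i, hi⟩)
      · rw [hatSeq_add_two, Finset.Ico_self, Finset.sum_empty]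
        rfl
  have hr : ∀ i ≤ b + 2, u (hatSeq inr i) = ∑ k ∈ Finset.Ico i (b + 2), G k := by
    rintro (_ | i) hi
    · rw [← Finset.range_eq_Ico, ← hFG, Finset.range_eq_Ico]
      rfl
    · obtain hi | rfl : i < b + 1 ∨ i = b + 1 := by omega
      · exact congrArg u (hatSeq_val_add_one inr ⟨i, hi⟩)
      · rw [hatSeq_add_two, Finset.Ico_self, Finset.sum_empty]
        rfl
  refine ⟨u, rfl, fun i hi => ?_, fun i hi => ?_⟩
  · rw [hl i hi.le, hl (i + 1) hi, Finset.sum_eq_sum_Ico_succ_bot hi, add_sub_cancel_right]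
  · rw [hr i hi.le, hr (i + 1) hi, Finset.sum_eq_sum_Ico_succ_bot hi, add_sub_cancel_right]

variable (a b) in
/-- The sum of the coordinates along the first chain minus the sum along the second. -/
def chainDiff : (Edge (Fin (a + 1) ⊕ Fin (b + 1)) → ℤ) →ₗ[ℤ] ℤ :=
  pathSum (hatSeq inl) (a + 2) - pathSum (hatSeq inr) (b + 2)

lemma ker_chainDiff : LinearMap.ker (chainDiff a b) = L (Fin (a + 1) ⊕ Fin (b + 1)) := by
  apply le_antisymm
  · intro f hf
    rw [LinearMap.mem_ker, chainDiff, LinearMap.sub_apply, sub_eq_zero, pathSum_apply,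
      pathSum_apply] at hf
    obtain ⟨u, htop, hl, hr⟩ := exists_potential _ _ hf
    refine mem_L_of_potential f u htop fun e => ?_
    rw [← edgeCoord_eq e f]
    obtain ⟨i, hi, h₁, h₂⟩ | ⟨i, hi, h₁, h₂⟩ := exists_hatSeq_of_covBy e.2
    · rw [h₁, h₂, hl i hi]
    · rw [h₁, h₂, hr i hi]
  · refine Submodule.span_le.2 ?_
    rintro _ ⟨z, -, rfl⟩
    by_cases hz : ⊥ = z <;>
      simp [chainDiff, pathSum_vz hatSeq_inl_covBy, pathSum_vz hatSeq_inr_covBy, hz]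

lemma chainDiff_allOnes :
    chainDiff a b (allOnes (Fin (a + 1) ⊕ Fin (b + 1))) = (a : ℤ) - b := by
  simp [chainDiff, pathSum_allOnes hatSeq_inl_covBy, pathSum_allOnes hatSeq_inr_covBy]

lemma exists_chainDiff_eq_one : ∃ f, chainDiff a b f = 1 := by
  let x₀ : Phat (Fin (a + 1) ⊕ Fin (b + 1)) := hatSeq inl 1
  refine ⟨fun e => if e.1.2 = x₀ then 1 else 0, ?_⟩
  have hx₀ : x₀ = _ := hatSeq_val_add_one inl 0
  rw [chainDiff, LinearMap.sub_apply,
    pathSum_of_endpoints hatSeq_inl_covBy fun _ y => if y = x₀ then 1 else 0,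
    pathSum_of_endpoints hatSeq_inr_covBy fun _ y => if y = x₀ then 1 else 0,
    Finset.sum_eq_single 0, Finset.sum_eq_zero]
  · simp [x₀]
  · intro i _
    rw [hx₀]
    by_cases hi : i < b + 1 <;> simp [hatSeq, hi]
  · intro i _ hi₀
    rw [hx₀]
    by_cases hi : i < a + 1 <;> simp [hatSeq, hi, Fin.ext_iff, hi₀]
  · simp

end TwoChains

/-- **Example 3.1.** Let `P` be the disjoint union of two chains
`P₁ : x₀ < ⋯ < x_a` and `P₂ : y₀ < ⋯ < y_b` (realized as `Fin (a+1) ⊕ Fin (b+1)` with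
the disjoint-union order, in which no element of `P₁` is comparable to any element of
`P₂`). Then `G = ℤ^{E(P̂)} / L` is infinite cyclic, with a generator `g` such that the
class of the all-ones vector satisfies `[𝟙] = (a − b) · g`. -/
theorem clGroup_twoChains_infinite_cyclic (a b : ℕ) :
    ∃ g : ClGroup (Fin (a + 1) ⊕ Fin (b + 1)),
      (∀ h : ClGroup (Fin (a + 1) ⊕ Fin (b + 1)), ∃ k : ℤ, h = k • g) ∧
      (∀ k : ℤ, k • g = 0 → k = 0) ∧
      (Submodule.Quotient.mk (allOnes (Fin (a + 1) ⊕ Fin (b + 1))) :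
          ClGroup (Fin (a + 1) ⊕ Fin (b + 1))) = ((a : ℤ) - (b : ℤ)) • g := by
  obtain ⟨d, hd⟩ := exists_chainDiff_eq_one (a := a) (b := b)
  have hmk : ∀ f, (Submodule.Quotient.mk f : ClGroup (Fin (a + 1) ⊕ Fin (b + 1))) =
      chainDiff a b f • Submodule.Quotient.mk d := by
    intro f
    rw [← Submodule.Quotient.mk_smul, Submodule.Quotient.eq, ← ker_chainDiff,
      LinearMap.mem_ker, map_sub, map_smul, hd, smul_eq_mul, mul_one, sub_self]
  refine ⟨Submodule.Quotient.mk d, fun h => ?_, fun k hk => ?_, ?_⟩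
  · obtain ⟨f, rfl⟩ := Submodule.Quotient.mk_surjective _ h
    exact ⟨_, hmk f⟩
  · rw [← Submodule.Quotient.mk_smul, Submodule.Quotient.mk_eq_zero, ← ker_chainDiff,
      LinearMap.mem_ker, map_smul, hd, smul_eq_mul, mul_one] at hk
    exact hk
  · rw [hmk, chainDiff_allOnes]

end
end
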